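/- Let d ≥ 1 be an integer and let β be a real number with 0 ≤ β < d. Let Y ⊆ ℝ^d be a countable union of compact sets, each of lower Minkowski dimension at most β. Then there exists a set X ⊆ ℝ^d with Hausdorff dimension at least d − β such that the sumset X + X = {x + y : x, y ∈ X} is disjoint from Y. -/

import Mathlib

open Filter Set

noncomputable section

/-- A dyadic length: a real number of the form `2 ^ (-k)` for a natural number `k`. -/
def IsDyadicLength (l : ℝ) : Prop := ∃ k : ℕ, l = (2 : ℝ) ^ (-(k : ℤ))

/-- The half-open dyadic cube of sidelength `l` with corner `l • m`. -/
def dyadicCube {ι : Type*} (l : ℝ) (m : ι → ℤ) : Set (ι → ℝ) :=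
  {x | ∀ i, l * (m i : ℝ) ≤ x i ∧ x i < l * ((m i : ℝ) + 1)}

/-- The (indices of the) cubes of `B_l` that intersect `E`. -/
def cubesMeeting {ι : Type*} (l : ℝ) (E : Set (ι → ℝ)) : Set (ι → ℤ) :=
  {m | (dyadicCube l m ∩ E).Nonempty}

/-- `#B_l(E)`, the number of cubes of sidelength `l` meeting `E`. -/
def cubeCount {ι : Type*} (l : ℝ) (E : Set (ι → ℝ)) : ℕ :=
  (cubesMeeting l E).ncard

/-- `E` is a union of cubes of `B_l`. -/
def IsCubeUnion {ι : Type*} (l : ℝ) (E : Set (ι → ℝ)) : Prop :=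
  ∃ S : Set (ι → ℤ), E = ⋃ m ∈ S, dyadicCube l m

/-- Lower Minkowski dimension, computed along dyadic scales. -/
def lowerMinkDim {ι : Type*} (Z : Set (ι → ℝ)) : ℝ :=
  Filter.atTop.liminf fun k : ℕ =>
    Real.log (cubeCount ((2 : ℝ) ^ (-(k : ℤ))) Z) / (k * Real.log 2)

/-- The unit cube `[0,1)^d`. -/
def unitCube (d : ℕ) : Set (Fin d → ℝ) := {x | ∀ i, x i ∈ Set.Ico (0 : ℝ) 1}

/-- `X^n`, viewed inside `ℝ^{dn} = (Fin n × Fin d → ℝ)`. -/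
def nthPower {d n : ℕ} (X : Set (Fin d → ℝ)) : Set (Fin n × Fin d → ℝ) :=
  {y | ∀ j, (fun i => y (j, i)) ∈ X}

/-- The point `(x_1, …, x_n) ∈ ℝ^{dn}` built from `x_1, …, x_n ∈ ℝ^d`. -/
def tuple {d n : ℕ} (x : Fin n → Fin d → ℝ) : Fin n × Fin d → ℝ := fun p => x p.1 p.2

/-- The `j`-th factor of a cube index in `B_l^{dn}`. -/
def cubeRow {d n : ℕ} (M : Fin n × Fin d → ℤ) (j : Fin n) : Fin d → ℤ := fun i => M (j, i)

/-- A cube of `B_l^{dn}` is strongly non-diagonal if its `n` factors are pairwise distinct. -/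
def StronglyNonDiagonal {d n : ℕ} (M : Fin n × Fin d → ℤ) : Prop :=
  Function.Injective (cubeRow M)

section

open scoped Pointwise ENNReal NNReal
open MeasureTheory Metric

/-- If the `δ`-neighbourhoods of `Z` have volume `O(δ ^ t)` and `X + Z` is not a null set, then
`X` has Hausdorff dimension at least `t`. -/
theorem ofReal_le_dimH_of_volume_add_ne_zero {d : ℕ} {X Z : Set (Fin d → ℝ)} {t δ₀ : ℝ} {C : ℝ≥0∞}
    (ht : 0 < t) (hδ₀ : 0 < δ₀) (hC : C ≠ ∞)
    (hZ : ∀ δ, 0 < δ → δ < δ₀ →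
      volume (⋃ z ∈ Z, closedBall z δ) ≤ C * ENNReal.ofReal (δ ^ t))
    (hXZ : volume (X + Z) ≠ 0) : ENNReal.ofReal t ≤ dimH X := by
  by_contra! hlt
  have hμ : μH[t] X = 0 := by
    have := hausdorffMeasure_of_dimH_lt (s := X) (d := t.toNNReal) hlt
    rwa [Real.coe_toNNReal _ ht.le] at this
  have hball : ∀ δ, 0 ≤ δ → δ < δ₀ →
      volume (⋃ z ∈ Z, closedBall z δ) ≤ C * ENNReal.ofReal (δ ^ t) := by
    intro δ h0 h1
    rcases h0.eq_or_lt with rfl | h0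
    · have hlim : Tendsto (fun δ : ℝ => C * ENNReal.ofReal (δ ^ t)) (nhdsWithin 0 (Ioi 0))
          (nhds (C * ENNReal.ofReal (0 ^ t))) := by
        refine ENNReal.Tendsto.const_mul ?_ (Or.inr hC)
        refine ENNReal.tendsto_ofReal ?_
        exact ((Real.continuousAt_rpow_const 0 t (Or.inr ht.le)).tendsto).mono_left
          nhdsWithin_le_nhds
      refine ge_of_tendsto hlim ?_
      filter_upwards [Ioo_mem_nhdsGT hδ₀] with δ hδ
      refine (measure_mono ?_).trans (hZ δ hδ.1 hδ.2)
      exact iUnion₂_mono fun z _ => closedBall_subset_closedBall hδ.1.le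
    · exact hZ δ h0 h1
  have hpiece : ∀ U : Set (Fin d → ℝ), ediam U ≤ ENNReal.ofReal (δ₀ / 2) →
      volume (U + Z) ≤ C * ⨆ _ : U.Nonempty, ediam U ^ t := by
    intro U hU
    rcases U.eq_empty_or_nonempty with rfl | ⟨x, hx⟩
    · simp
    have hfin : ediam U ≠ ∞ := ne_top_of_le_ne_top ENNReal.ofReal_ne_top hU
    have hdiam : diam U ≤ δ₀ / 2 := ENNReal.toReal_le_of_le_ofReal (by positivity) hU
    have hsub : U + Z ⊆ (fun y => -x + y) ⁻¹' ⋃ z ∈ Z, closedBall z (diam U) := by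
      rintro _ ⟨u, hu, z, hz, rfl⟩
      simp only [mem_preimage, mem_iUnion]
      refine ⟨z, hz, ?_⟩
      rw [mem_closedBall, dist_eq_norm, show -x + (u + z) - z = u - x by abel, ← dist_eq_norm]
      exact dist_le_diam_of_mem' hfin hu hx
    have hnon : U.Nonempty := ⟨x, hx⟩
    calc volume (U + Z) ≤ _ := measure_mono hsub
      _ = volume (⋃ z ∈ Z, closedBall z (diam U)) := measure_preimage_add _ _ _
      _ ≤ C * ENNReal.ofReal (diam U ^ t) := hball _ diam_nonneg (by linarith)
      _ = C * ⨆ _ : U.Nonempty, ediam U ^ t := by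
        simp only [hnon, iSup_pos]
        rw [← ENNReal.ofReal_rpow_of_nonneg diam_nonneg ht.le, diam, ENNReal.ofReal_toReal hfin]
  rw [Measure.hausdorffMeasure_apply] at hμ
  have hinf : (⨅ (U : ℕ → Set (Fin d → ℝ)) (_ : X ⊆ ⋃ n, U n)
      (_ : ∀ n, ediam (U n) ≤ ENNReal.ofReal (δ₀ / 2)),
        ∑' n, ⨆ _ : (U n).Nonempty, ediam (U n) ^ t) = 0 := by
    simp only [ENNReal.iSup_eq_zero] at hμ
    exact hμ _ (by simpa using hδ₀)
  refine hXZ (le_antisymm (ENNReal.le_of_forall_pos_le_add fun e he _ => ?_) bot_le)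
  have hpos : (0 : ℝ≥0∞) < e / C := ENNReal.div_pos (by simpa using he.ne') hC
  rw [← hinf] at hpos
  simp only [iInf_lt_iff] at hpos
  obtain ⟨U, hXU, hU, hsum⟩ := hpos
  rw [zero_add]
  calc volume (X + Z) ≤ volume (⋃ n, (U n + Z)) := by
        rw [← iUnion_add]; exact measure_mono (add_subset_add_right hXU)
    _ ≤ ∑' n, volume (U n + Z) := measure_iUnion_le _
    _ ≤ ∑' n, C * ⨆ _ : (U n).Nonempty, ediam (U n) ^ t :=
        ENNReal.tsum_le_tsum fun n => hpiece _ (hU n)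
    _ = C * ∑' n, ⨆ _ : (U n).Nonempty, ediam (U n) ^ t := ENNReal.tsum_mul_left
    _ ≤ C * (e / C) := by gcongr
    _ ≤ e := ENNReal.mul_div_le

theorem cubesMeeting_subset_Icc {ι : Type*} {E : Set (ι → ℝ)} {R k : ℕ}
    (hE : ∀ x ∈ E, ∀ i, |x i| ≤ R) :
    cubesMeeting ((2 : ℝ) ^ (-(k : ℤ))) E ⊆
      Icc (fun _ => -((R : ℤ) * 2 ^ k) - 1) (fun _ => (R : ℤ) * 2 ^ k) := by
  rintro m ⟨x, hx, hxE⟩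
  have key : ∀ i, (-((R : ℝ) * 2 ^ k) < m i + 1) ∧ (m i : ℝ) ≤ R * 2 ^ k := by
    intro i
    obtain ⟨h1, h2⟩ := hx i
    obtain ⟨h3, h4⟩ := abs_le.1 (hE x hxE i)
    rw [zpow_neg, zpow_natCast, inv_mul_eq_div] at h1 h2
    have hp : (0 : ℝ) < 2 ^ k := by positivity
    rw [div_le_iff₀ hp] at h1
    rw [lt_div_iff₀ hp] at h2
    constructor <;> nlinarith
  refine ⟨fun i => ?_, fun i => ?_⟩
  · have := (key i).1
    have h : -((R : ℤ) * 2 ^ k) < m i + 1 := by exact_mod_cast this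
    show -((R : ℤ) * 2 ^ k) - 1 ≤ m i
    linarith
  · exact_mod_cast (key i).2

theorem cubeCount_le {d : ℕ} {E : Set (Fin d → ℝ)} {R k : ℕ} (hE : ∀ x ∈ E, ∀ i, |x i| ≤ R) :
    cubeCount ((2 : ℝ) ^ (-(k : ℤ))) E ≤ ((2 * R + 2) * 2 ^ k) ^ d := by
  refine (ncard_le_ncard (cubesMeeting_subset_Icc hE) (finite_Icc _ _)).trans ?_
  rw [← Finset.coe_Icc, ncard_coe_finset, Pi.card_Icc]
  simp only [Int.card_Icc, Finset.prod_const, Finset.card_univ, Fintype.card_fin]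
  refine Nat.pow_le_pow_left ?_ d
  have h1 : (1 : ℤ) ≤ 2 ^ k := one_le_pow₀ (by norm_num)
  rw [Int.toNat_le]
  push_cast
  nlinarith

theorem exists_nat_abs_le_of_isCompact {d : ℕ} {E : Set (Fin d → ℝ)} (hE : IsCompact E) :
    ∃ R : ℕ, ∀ x ∈ E, ∀ i, |x i| ≤ R := by
  obtain ⟨r, hr⟩ := hE.isBounded.exists_norm_le
  obtain ⟨R, hR⟩ := exists_nat_ge r
  exact ⟨R, fun x hx i => (norm_le_pi_norm x i).trans ((hr x hx).trans hR)⟩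

/-- At infinitely many dyadic scales the number of cubes is controlled by the lower Minkowski
dimension. -/
theorem frequently_cubeCount_lt {d : ℕ} {E : Set (Fin d → ℝ)} (hE : IsCompact E) {s : ℝ}
    (hs : lowerMinkDim E < s) :
    ∃ᶠ k : ℕ in atTop, (cubeCount ((2 : ℝ) ^ (-(k : ℤ))) E : ℝ) ≤ 2 ^ ((k : ℝ) * s) := by
  obtain ⟨R, hR⟩ := exists_nat_abs_le_of_isCompact hE
  have hlog2 : 0 < Real.log 2 := Real.log_pos one_lt_two
  have hbdd : IsBoundedUnder (· ≤ ·) atTop fun k : ℕ =>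
      Real.log (cubeCount ((2 : ℝ) ^ (-(k : ℤ))) E) / (k * Real.log 2) := by
    refine ⟨d * (Real.log (2 * R + 2) / Real.log 2 + 1), ?_⟩
    rw [eventually_map]
    filter_upwards [eventually_ge_atTop 1] with k hk
    have hk' : (1 : ℝ) ≤ k := by exact_mod_cast hk
    have hA : 0 ≤ Real.log (2 * R + 2) := Real.log_nonneg (by linarith [R.cast_nonneg (α := ℝ)])
    rw [div_le_iff₀ (by positivity)]
    have h1 : Real.log (cubeCount ((2 : ℝ) ^ (-(k : ℤ))) E) ≤
        d * (Real.log (2 * R + 2) + k * Real.log 2) := by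
      rcases (cubeCount ((2 : ℝ) ^ (-(k : ℤ))) E).eq_zero_or_pos with h0 | h0
      · rw [h0]; simp only [Nat.cast_zero, Real.log_zero]; positivity
      · calc Real.log (cubeCount ((2 : ℝ) ^ (-(k : ℤ))) E)
            ≤ Real.log (((2 * R + 2) * 2 ^ k) ^ d) :=
              Real.log_le_log (by exact_mod_cast h0) (by exact_mod_cast cubeCount_le hR)
          _ = _ := by
              rw [Real.log_pow, Real.log_mul (by positivity) (by positivity), Real.log_pow]
    refine h1.trans ?_
    have h2 : Real.log (2 * R + 2) ≤ Real.log (2 * R + 2) * k := le_mul_of_one_le_right hA hk'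
    calc d * (Real.log (2 * R + 2) + k * Real.log 2)
        ≤ d * (Real.log (2 * R + 2) * k + k * Real.log 2) := by gcongr
      _ = _ := by field_simp
  refine ((frequently_lt_of_liminf_lt hbdd.isCoboundedUnder_ge hs).and_eventually
    (eventually_ge_atTop 1)).mono ?_
  rintro k ⟨hk, hk1⟩
  have hk' : (0 : ℝ) < k := by exact_mod_cast hk1
  rcases (cubeCount ((2 : ℝ) ^ (-(k : ℤ))) E).eq_zero_or_pos with h0 | h0
  · rw [h0, Nat.cast_zero]; positivity
  · rw [div_lt_iff₀ (by positivity)] at hk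
    rw [← Real.log_le_log_iff (by exact_mod_cast h0) (by positivity),
      Real.log_rpow two_pos]
    linarith

/-- `E` avoids the points within `4 * l` of the lattice `l • (w + M • ℤ ^ d)`. -/
def AvoidsLattice {d : ℕ} (E : Set (Fin d → ℝ)) (l : ℝ) (M : ℕ) (w : Fin d → ℤ) : Prop :=
  ∀ p ∈ E, ∀ n : Fin d → ℤ, ∃ i, 4 * l < |p i - l * (M * n i + w i)|

/-- Pigeonhole on residues modulo `M`: a set meeting few cubes of sidelength `l` avoids some
translate of a neighbourhood of the lattice `(l * M) • ℤ ^ d`. -/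
theorem exists_avoidsLattice {d : ℕ} {E : Set (Fin d → ℝ)} {l : ℝ} {M : ℕ} (hl : 0 < l)
    (hfin : (cubesMeeting l E).Finite) (hM : 1 ≤ M) (hcount : cubeCount l E * 9 ^ d < M ^ d) :
    ∃ w : Fin d → ℤ, AvoidsLattice E l M w := by
  classical
  have : NeZero M := ⟨by omega⟩
  let bad : Finset (Fin d → ZMod M) :=
    Finset.image₂ (fun m e i => ((m i + e i : ℤ) : ZMod M)) hfin.toFinset
      (Fintype.piFinset fun _ : Fin d => Finset.Icc (-4 : ℤ) 4)
  have hbad : bad.card < Fintype.card (Fin d → ZMod M) := by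
    refine (Finset.card_image₂_le _ _ _).trans_lt ?_
    rw [← ncard_eq_toFinset_card _ hfin, Fintype.card_piFinset, Fintype.card_fun]
    simp only [Int.card_Icc, Finset.prod_const, Finset.card_univ, Fintype.card_fin, ZMod.card]
    refine lt_of_le_of_lt ?_ hcount
    exact Nat.mul_le_mul_left _ (Nat.pow_le_pow_left (by decide) d)
  obtain ⟨u, hu⟩ : ∃ u, u ∉ bad := by
    by_contra! h
    exact hbad.ne (by rw [Finset.eq_univ_of_forall h, Finset.card_univ])
  refine ⟨fun i => ((u i).val : ℤ), fun p hp n => ?_⟩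
  by_contra! hnear
  refine hu (Finset.mem_image₂.2 ⟨fun i => ⌊p i / l⌋, ?_,
    fun i => M * n i + (u i).val - ⌊p i / l⌋, ?_, ?_⟩)
  · rw [Finite.mem_toFinset]
    refine ⟨p, fun i => ⟨?_, ?_⟩, hp⟩
    · rw [mul_comm, ← le_div_iff₀ hl]; exact Int.floor_le _
    · rw [mul_comm, ← div_lt_iff₀ hl]; exact Int.lt_floor_add_one _
  · rw [Fintype.mem_piFinset]
    intro i
    obtain ⟨h1, h2⟩ := abs_le.1 (hnear i)
    set c : ℤ := M * n i + (u i).val with hc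
    have hcr : (M * n i + ((u i).val : ℤ) : ℝ) = c := by rw [hc]; push_cast; ring
    rw [hcr] at h1 h2
    have h3 : p i / l ≤ c + 4 := by rw [div_le_iff₀ hl]; linarith
    have h4 : (c : ℝ) - 4 ≤ p i / l := by rw [le_div_iff₀ hl]; linarith
    have h5 : c - 4 ≤ ⌊p i / l⌋ := Int.le_floor.2 (by push_cast; exact h4)
    have h6 : ⌊p i / l⌋ ≤ c + 4 := by
      have : (⌊p i / l⌋ : ℝ) ≤ c + 4 := (Int.floor_le _).trans h3
      exact_mod_cast this
    rw [Finset.mem_Icc]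
    constructor <;> linarith
  · funext i
    simp

/-- Arbitrarily fine scales `l` at which `E` avoids a lattice of mesh `l * M`, where
`M ^ d` is almost as small as the dimension of `E` permits. -/
theorem exists_scale_avoidsLattice {d : ℕ} (hd : 1 ≤ d) {E : Set (Fin d → ℝ)} (hE : IsCompact E)
    {β ε η : ℝ} (hβ : 0 ≤ β) (hε : 0 < ε) (hβε : β + ε < d) (hdim : lowerMinkDim E ≤ β)
    (hη : 0 < η) :
    ∃ (l : ℝ) (M : ℕ) (w : Fin d → ℤ), 0 < l ∧ 1 ≤ M ∧ (M : ℝ) ^ d ≤ l ^ (-(β + ε)) ∧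
      l * M ≤ η ∧ AvoidsLattice E l M w := by
  obtain ⟨R, hR⟩ := exists_nat_abs_le_of_isCompact hE
  have hd0 : (0 : ℝ) < d := by exact_mod_cast hd
  have hpow : ∀ c : ℝ, 0 < c → Tendsto (fun b : ℕ => (2 : ℝ) ^ ((b : ℝ) * c)) atTop atTop := by
    intro c hc
    simp_rw [mul_comm _ c, Real.rpow_mul_natCast zero_le_two]
    exact tendsto_pow_atTop_atTop_of_one_lt (Real.one_lt_rpow one_lt_two hc)
  set s := (β + ε) / d with hs
  have hs1 : s < 1 := (div_lt_one hd0).2 hβε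
  have hs0 : 0 ≤ s := by positivity
  obtain ⟨b, hcount, hb1, hb2⟩ := ((frequently_cubeCount_lt hE
    (s := β + ε / 2) (by linarith)).and_eventually
    (((hpow (ε / 2) (by positivity)).eventually_gt_atTop (18 ^ d)).and
      ((hpow (1 - s) (by linarith)).eventually_ge_atTop η⁻¹))).exists
  set l : ℝ := (2 : ℝ) ^ (-(b : ℤ)) with hldef
  have hlr : l = 2 ^ (-(b : ℝ)) := by
    rw [hldef, ← Real.rpow_intCast]; push_cast; rfl
  have hl : 0 < l := by positivity
  set T : ℝ := 2 ^ ((b : ℝ) * s) with hT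
  have hT1 : 1 ≤ T := Real.one_le_rpow one_le_two (by positivity)
  have hTd : T ^ d = 2 ^ ((b : ℝ) * (β + ε)) := by
    rw [hT, ← Real.rpow_mul_natCast zero_le_two, hs]
    congr 1
    field_simp
  have hM1 : 1 ≤ ⌊T⌋₊ := Nat.le_floor (by exact_mod_cast hT1)
  have hMT : (⌊T⌋₊ : ℝ) ≤ T := Nat.floor_le (by linarith)
  have hTM : T ≤ 2 * (⌊T⌋₊ : ℝ) := by
    have h1 := Nat.lt_floor_add_one T
    have h2 : (1 : ℝ) ≤ ⌊T⌋₊ := by exact_mod_cast hM1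
    linarith
  obtain ⟨w, hw⟩ := exists_avoidsLattice (E := E) (M := ⌊T⌋₊) hl
    ((finite_Icc _ _).subset (cubesMeeting_subset_Icc hR)) hM1 (by
      have hlt : (cubeCount l E : ℝ) * 18 ^ d < (2 * (⌊T⌋₊ : ℝ)) ^ d := by
        calc (cubeCount l E : ℝ) * 18 ^ d
            ≤ 2 ^ ((b : ℝ) * (β + ε / 2)) * 18 ^ d := by gcongr
          _ < 2 ^ ((b : ℝ) * (β + ε / 2)) * 2 ^ ((b : ℝ) * (ε / 2)) := by gcongr
          _ = T ^ d := by rw [hTd, ← Real.rpow_add two_pos]; congr 1; ring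
          _ ≤ _ := by gcongr
      rw [mul_pow, show (18 : ℝ) = 2 * 9 by norm_num, mul_pow, mul_left_comm] at hlt
      have := lt_of_mul_lt_mul_left hlt (by positivity)
      exact_mod_cast this)
  refine ⟨l, ⌊T⌋₊, w, hl, hM1, ?_, ?_, hw⟩
  · calc (⌊T⌋₊ : ℝ) ^ d ≤ T ^ d := by gcongr
      _ = l ^ (-(β + ε)) := by
        rw [hTd, hlr, ← Real.rpow_mul zero_le_two]; congr 1; ring
  · calc l * ⌊T⌋₊ ≤ l * T := by gcongr
      _ = (2 ^ ((b : ℝ) * (1 - s)))⁻¹ := by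
        rw [hlr, hT, ← Real.rpow_add two_pos, ← Real.rpow_neg zero_le_two]; congr 1; ring
      _ ≤ η := inv_le_of_inv_le₀ hη hb2

/-- Rapidly decreasing scales `l k` together with integers `M k`: `M k ^ d` is at most about
`(l k) ^ (-β)`, and the products of the earlier `M j ^ d` are negligible at the scale
`l k * M k`. -/
structure IsSparseScales (d : ℕ) (β : ℝ) (l : ℕ → ℝ) (M : ℕ → ℕ) : Prop where
  pos : ∀ k, 0 < l k
  one_le : ∀ k, 1 ≤ M k
  pow_le : ∀ k : ℕ, (M k : ℝ) ^ d ≤ l k ^ (-(β + (d - β) / (k + 2)))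
  mesh_zero_le : l 0 * M 0 ≤ 1
  mesh_succ_le : ∀ k, l (k + 1) * M (k + 1) ≤ l k / 4
  prod_le : ∀ k, (∏ j ∈ Finset.range k, (M j : ℝ) ^ d) ^ k * (l k * M k) ≤ 1

theorem exists_isSparseScales {d : ℕ} (hd : 1 ≤ d) {β : ℝ} (hβ : 0 ≤ β) (hβd : β < d)
    {Y : ℕ → Set (Fin d → ℝ)} (hY : ∀ i, IsCompact (Y i)) (hdim : ∀ i, lowerMinkDim (Y i) ≤ β) :
    ∃ (l : ℕ → ℝ) (M : ℕ → ℕ) (w : ℕ → Fin d → ℤ), IsSparseScales d β l M ∧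
      ∀ k, AvoidsLattice (Y k) (l k) (M k) (w k) := by
  have hε : ∀ k : ℕ, 0 < (d - β) / ((k : ℝ) + 2) ∧ β + (d - β) / ((k : ℝ) + 2) < d := by
    intro k
    have h : 0 < d - β := by linarith
    have : (d - β) / ((k : ℝ) + 2) < d - β :=
      div_lt_self h (by linarith [k.cast_nonneg (α := ℝ)])
    exact ⟨by positivity, by linarith⟩
  have hstep : ∀ (k : ℕ) (η : {η : ℝ // 0 < η}), _ := fun k η =>
    exists_scale_avoidsLattice hd (hY k) hβ (hε k).1 (hε k).2 (hdim k) η.2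
  choose l M w hl hM hMl hlη hav using hstep
  let next : ℕ → {η : ℝ // 0 < η} × ℕ → {η : ℝ // 0 < η} × ℕ := fun k S =>
    let P := S.2 * M k S.1 ^ d
    (⟨min (l k S.1 / 4) (((P : ℝ) + 1)⁻¹ ^ (k + 1)),
      lt_min (div_pos (hl _ _) four_pos) (by positivity)⟩, P)
  let S : ℕ → {η : ℝ // 0 < η} × ℕ := fun k => Nat.rec (⟨1, one_pos⟩, 1) next k
  have hS : ∀ k, S (k + 1) = next k (S k) := fun k => rfl
  have hP : ∀ k, ((S k).2 : ℝ) = ∏ j ∈ Finset.range k, (M j (S j).1 : ℝ) ^ d := by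
    intro k
    induction k with
    | zero => simp [S]
    | succ k ih => rw [Finset.prod_range_succ, ← ih, hS]; simp [next]
  have hη : ∀ k, ((S k).1 : ℝ) ≤ (((S k).2 : ℝ) + 1)⁻¹ ^ k := by
    rintro (_ | k)
    · simp [S]
    · exact min_le_right _ _
  refine ⟨fun k => l k (S k).1, fun k => M k (S k).1, fun k => w k (S k).1,
    ⟨fun k => hl _ _, fun k => hM _ _, fun k => hMl _ _, hlη 0 _,
      fun k => (hlη _ _).trans (min_le_left _ _), fun k => ?_⟩, fun k => hav _ _⟩
  rw [← hP k]
  calc ((S k).2 : ℝ) ^ k * (l k (S k).1 * M k (S k).1)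
      ≤ (((S k).2 : ℝ) + 1) ^ k * (((S k).2 : ℝ) + 1)⁻¹ ^ k := by
        have := (hlη k (S k).1).trans (hη k)
        have h0 := (hl k (S k).1).le
        gcongr
        linarith
    _ = 1 := by rw [← mul_pow, mul_inv_cancel₀ (by positivity), one_pow]

/-- The points that, for every `k`, are within `2 * l k` of `l k • (w k / 2 + M k • ℤ ^ d)`. -/
def latticeCantorSet {d : ℕ} (l : ℕ → ℝ) (M : ℕ → ℕ) (w : ℕ → Fin d → ℤ) : Set (Fin d → ℝ) :=
  {x | ∀ k, ∃ n : Fin d → ℤ, ∀ i, |x i - l k * (M k * n i + w k i / 2)| ≤ 2 * l k}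

/-- The sums `∑ j < k, l j • c j` with `c j` having entries in `{0, …, M j - 1}`. -/
def digitSums (d : ℕ) (l : ℕ → ℝ) (M : ℕ → ℕ) : ℕ → Finset (Fin d → ℝ)
  | 0 => {0}
  | k + 1 => Finset.image₂ (fun f (c : Fin d → Fin (M k)) i => f i + l k * (c i : ℕ))
      (digitSums d l M k) Finset.univ

/-- The points that are close to `digitSums d l M k` for every `k`. -/
def digitSet (d : ℕ) (l : ℕ → ℝ) (M : ℕ → ℕ) : Set (Fin d → ℝ) :=
  {z | ∀ k, ∃ f ∈ digitSums d l M k, dist f z ≤ 2 * (l k * M k)}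

theorem card_digitSums_le (d : ℕ) (l : ℕ → ℝ) (M : ℕ → ℕ) (k : ℕ) :
    (digitSums d l M k).card ≤ ∏ j ∈ Finset.range k, M j ^ d := by
  induction k with
  | zero => simp [digitSums]
  | succ k ih =>
    rw [Finset.prod_range_succ]
    refine (Finset.card_image₂_le _ _ _).trans ?_
    rw [Finset.card_univ, Fintype.card_fun, Fintype.card_fin, Fintype.card_fin]
    exact Nat.mul_le_mul_right _ ih

theorem disjoint_latticeCantorSet_add {d : ℕ} {l : ℕ → ℝ} {M : ℕ → ℕ} {w : ℕ → Fin d → ℤ}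
    {E : Set (Fin d → ℝ)} {k : ℕ} (hE : AvoidsLattice E (l k) (M k) (w k)) :
    Disjoint (latticeCantorSet l M w + latticeCantorSet l M w) E := by
  rw [Set.disjoint_left]
  rintro _ ⟨x, hx, y, hy, rfl⟩ hxy
  obtain ⟨n, hn⟩ := hx k
  obtain ⟨m, hm⟩ := hy k
  obtain ⟨i, hi⟩ := hE _ hxy (n + m)
  refine hi.not_ge ?_
  calc |(x + y) i - l k * (M k * ((n + m) i : ℤ) + w k i)|
      = |(x i - l k * (M k * n i + w k i / 2)) + (y i - l k * (M k * m i + w k i / 2))| := by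
        simp only [Pi.add_apply]; push_cast; congr 1; ring
    _ ≤ _ := abs_add_le _ _
    _ ≤ 4 * l k := by linarith [hn i, hm i]

theorem IsSparseScales.mesh_add_le {d : ℕ} {β : ℝ} {l : ℕ → ℝ} {M : ℕ → ℕ}
    (h : IsSparseScales d β l M) (k j : ℕ) :
    l (k + j) * M (k + j) ≤ l k * M k * (1 / 4) ^ j := by
  induction j with
  | zero => simp
  | succ j ih =>
    have h1 : (1 : ℝ) ≤ M (k + j) := by exact_mod_cast h.one_le _
    have h2 := le_mul_of_one_le_right (h.pos (k + j)).le h1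
    have h3 := h.mesh_succ_le (k + j)
    rw [← add_assoc, pow_succ]
    linarith

theorem IsSparseScales.tendsto_mesh {d : ℕ} {β : ℝ} {l : ℕ → ℝ} {M : ℕ → ℕ}
    (h : IsSparseScales d β l M) : Tendsto (fun k => l k * M k) atTop (nhds 0) := by
  refine squeeze_zero (fun k => by have := h.pos k; positivity)
    (fun k => (zero_add k ▸ h.mesh_add_le 0 k : _)) ?_
  simpa using (tendsto_pow_atTop_nhds_zero_of_lt_one (r := (1 / 4 : ℝ)) (by norm_num)
    (by norm_num)).const_mul (l 0 * M 0)

theorem latticeCantorSet_add_digitSet {d : ℕ} {β : ℝ} {l : ℕ → ℝ} {M : ℕ → ℕ}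
    (h : IsSparseScales d β l M) (w : ℕ → Fin d → ℤ) :
    latticeCantorSet l M w + digitSet d l M = univ := by
  refine eq_univ_of_forall fun p => ?_
  have hM : ∀ k, (0 : ℤ) < M k := fun k => by exact_mod_cast h.one_le k
  let c : ℕ → (Fin d → ℝ) → Fin d → ℤ := fun k s i => ⌊(p i - s i) / l k - w k i / 2⌋
  let s : ℕ → Fin d → ℝ := fun k =>
    Nat.rec 0 (fun k s i => s i + l k * ((c k s i % M k : ℤ) : ℝ)) k
  have hs : ∀ k i, s (k + 1) i = s k i + l k * ((c k (s k) i % M k : ℤ) : ℝ) := fun k i => rfl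
  have hmod : ∀ k i, (0 : ℝ) ≤ ((c k (s k) i % M k : ℤ) : ℝ) ∧
      ((c k (s k) i % M k : ℤ) : ℝ) ≤ M k := by
    intro k i
    exact ⟨by exact_mod_cast Int.emod_nonneg _ (hM k).ne',
      by exact_mod_cast (Int.emod_lt_of_pos _ (hM k)).le⟩
  have hsF : ∀ k, s k ∈ digitSums d l M k := by
    intro k
    induction k with
    | zero => exact Finset.mem_singleton_self _
    | succ k ih =>
      have hnn : ∀ i, 0 ≤ c k (s k) i % M k := fun i => Int.emod_nonneg _ (hM k).ne'
      refine Finset.mem_image₂.2 ⟨s k, ih, fun i => ⟨(c k (s k) i % M k).toNat, ?_⟩,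
        Finset.mem_univ _, ?_⟩
      · rw [Int.toNat_lt (hnn i)]; exact Int.emod_lt_of_pos _ (hM k)
      · funext i
        rw [hs]
        congr 2
        exact_mod_cast Int.toNat_of_nonneg (hnn i)
  have hdist : ∀ k j, dist (s (k + j)) (s (k + (j + 1))) ≤ l k * M k * (1 / 4) ^ j := by
    intro k j
    refine le_trans ?_ (h.mesh_add_le k j)
    have hl := (h.pos (k + j)).le
    rw [dist_pi_le_iff (by positivity)]
    intro i
    rw [← add_assoc, hs, Real.dist_eq, sub_add_cancel_left, abs_neg,
      abs_of_nonneg (mul_nonneg hl (hmod _ _).1)]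
    exact mul_le_mul_of_nonneg_left (hmod _ _).2 hl
  obtain ⟨z, hz⟩ := cauchySeq_tendsto_of_complete
    (cauchySeq_of_le_geometric (1 / 4) _ (by norm_num) (fun j => by simpa using hdist 0 j))
  have hsz : ∀ k, dist (s k) z ≤ 4 / 3 * (l k * M k) := fun k =>
    (dist_le_of_le_geometric_of_tendsto₀ (f := fun j => s (k + j)) (1 / 4) _ (by norm_num)
      (hdist k) (hz.comp (tendsto_add_atTop_nat k |>.congr fun j => add_comm j k))).trans_eq
      (by ring)
  refine ⟨p - z, fun k => ⟨fun i => c k (s k) i / M k, fun i => ?_⟩, z, fun k =>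
    ⟨s k, hsF k, (hsz k).trans ?_⟩, sub_add_cancel p z⟩
  · have hl := h.pos k
    have h1 : |s (k + 1) i - z i| ≤ l k := by
      have h2 := (dist_le_pi_dist (s (k + 1)) z i).trans (hsz (k + 1))
      rw [Real.dist_eq] at h2
      have h3 := h.mesh_succ_le k
      linarith
    have hdiv : (M k : ℝ) * ((c k (s k) i / M k : ℤ) : ℝ) = c k (s k) i -
        ((c k (s k) i % M k : ℤ) : ℝ) := by
      have := Int.mul_ediv_add_emod (c k (s k) i) (M k)
      rw [eq_sub_iff_add_eq]
      exact_mod_cast this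
    have h4 : |p i - s (k + 1) i - l k * (M k * ((c k (s k) i / M k : ℤ) : ℝ) + w k i / 2)|
        ≤ l k := by
      have h5 : p i - s (k + 1) i - l k * (M k * ((c k (s k) i / M k : ℤ) : ℝ) + w k i / 2) =
          l k * Int.fract ((p i - s k i) / l k - w k i / 2) := by
        rw [hdiv, hs, Int.fract]
        simp only [c]
        field_simp
        ring
      rw [h5, abs_mul, abs_of_pos hl, abs_of_nonneg (Int.fract_nonneg _)]
      exact mul_le_of_le_one_right hl.le (Int.fract_lt_one _).le
    calc |(p - z) i - l k * (M k * ((c k (s k) i / M k : ℤ) : ℝ) + w k i / 2)|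
        = |(p i - s (k + 1) i - l k * (M k * ((c k (s k) i / M k : ℤ) : ℝ) + w k i / 2)) +
            (s (k + 1) i - z i)| := by congr 1; simp only [Pi.sub_apply]; ring
      _ ≤ _ := abs_add_le _ _
      _ ≤ 2 * l k := by linarith
  · have : 0 ≤ l k * M k := by have := h.pos k; positivity
    linarith

theorem volume_iUnion_closedBall_digitSet_le {d : ℕ} {l : ℕ → ℝ} {M : ℕ → ℕ} {δ ρ : ℝ} (k : ℕ)
    (hδ : 0 ≤ δ) (hl : 0 ≤ l k) (hρ : 2 * (l k * M k) + δ ≤ ρ) :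
    volume (⋃ z ∈ digitSet d l M, closedBall z δ) ≤
      ENNReal.ofReal ((∏ j ∈ Finset.range k, (M j : ℝ) ^ d) * (2 * ρ) ^ d) := by
  have hρ0 : 0 ≤ ρ := le_trans (by positivity) hρ
  have hsub : (⋃ z ∈ digitSet d l M, closedBall z δ) ⊆
      ⋃ f ∈ digitSums d l M k, closedBall f ρ := by
    refine iUnion₂_subset fun z hz y hy => ?_
    obtain ⟨f, hf, hfz⟩ := hz k
    refine mem_iUnion₂.2 ⟨f, hf, ?_⟩
    rw [mem_closedBall] at hy ⊢
    rw [dist_comm] at hfz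
    linarith [dist_triangle y z f]
  calc _ ≤ volume (⋃ f ∈ digitSums d l M k, closedBall f ρ) := measure_mono hsub
    _ ≤ ∑ f ∈ digitSums d l M k, volume (closedBall f ρ) := measure_biUnion_finset_le _ _
    _ = ENNReal.ofReal ((digitSums d l M k).card * (2 * ρ) ^ d) := by
      simp only [Real.volume_pi_closedBall _ hρ0, Fintype.card_fin, Finset.sum_const,
        nsmul_eq_mul]
      rw [ENNReal.ofReal_mul (by positivity), ENNReal.ofReal_natCast]
    _ ≤ _ := by
      gcongr
      exact_mod_cast card_digitSums_le d l M k

theorem IsSparseScales.prod_le_rpow {d : ℕ} {β : ℝ} {l : ℕ → ℝ} {M : ℕ → ℕ}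
    (h : IsSparseScales d β l M) {k : ℕ} (hk : k ≠ 0) {δ : ℝ} (hδ : 0 < δ)
    (hδk : δ ≤ l k * M k) :
    ∏ j ∈ Finset.range k, (M j : ℝ) ^ d ≤ δ ^ (-(1 / (k : ℝ))) := by
  set P := ∏ j ∈ Finset.range k, (M j : ℝ) ^ d with hP
  have hP0 : 0 ≤ P := by positivity
  have h1 : P ^ k ≤ δ⁻¹ := by
    rw [← one_div, le_div_iff₀ hδ]
    exact (mul_le_mul_of_nonneg_left hδk (by positivity)).trans (h.prod_le k)
  calc P = (P ^ k) ^ (1 / (k : ℝ)) := by rw [one_div, Real.pow_rpow_inv_natCast hP0 hk]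
    _ ≤ δ⁻¹ ^ (1 / (k : ℝ)) := by gcongr
    _ = δ ^ (-(1 / (k : ℝ))) := by rw [Real.rpow_neg hδ.le, Real.inv_rpow hδ.le]

theorem IsSparseScales.volume_digitSet_le {d : ℕ} {β : ℝ} (hβ : 0 ≤ β) (hβd : β < d)
    {l : ℕ → ℝ} {M : ℕ → ℕ}
    (h : IsSparseScales d β l M) {k : ℕ} (hk : k ≠ 0) {δ : ℝ} (hδ : 0 < δ)
    (hδk : δ ≤ l k * M k) (hkδ : l (k + 1) * M (k + 1) ≤ δ) :
    volume (⋃ z ∈ digitSet d l M, closedBall z δ) ≤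
      ENNReal.ofReal (6 ^ d * δ ^ (d - β - ((d - β) / (k + 2) + 1 / k))) := by
  set ε := (d - β) / ((k : ℝ) + 2) with hε
  have hεd : ε ≤ d - β := div_le_self (by linarith) (by linarith [k.cast_nonneg (α := ℝ)])
  have hε0 : 0 ≤ ε := div_nonneg (by linarith) (by positivity)
  have hl := h.pos k
  have hP := h.prod_le_rpow hk hδ hδk
  set P := ∏ j ∈ Finset.range k, (M j : ℝ) ^ d
  suffices hmain : ∃ j : ℕ, ∃ ρ : ℝ, 2 * (l j * M j) + δ ≤ 3 * ρ ∧
      (∏ i ∈ Finset.range j, (M i : ℝ) ^ d) * ρ ^ d ≤ P * δ ^ (d - β - ε) by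
    obtain ⟨j, ρ, h1, h2⟩ := hmain
    refine (volume_iUnion_closedBall_digitSet_le j hδ.le (h.pos j).le h1).trans
      (ENNReal.ofReal_le_ofReal ?_)
    calc (∏ i ∈ Finset.range j, (M i : ℝ) ^ d) * (2 * (3 * ρ)) ^ d
        = 6 ^ d * ((∏ i ∈ Finset.range j, (M i : ℝ) ^ d) * ρ ^ d) := by
          rw [show 2 * (3 * ρ) = 6 * ρ by ring, mul_pow]; ring
      _ ≤ 6 ^ d * (δ ^ (-(1 / (k : ℝ))) * δ ^ (d - β - ε)) := by
          exact mul_le_mul_of_nonneg_left (h2.trans (by gcongr)) (by positivity)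
      _ = _ := by rw [← Real.rpow_add hδ]; congr 2; ring
  rcases le_total (l k) δ with hlδ | hlδ
  · refine ⟨k, l k * M k, by linarith, ?_⟩
    gcongr
    calc (l k * M k) ^ d = l k ^ (d : ℝ) * (M k : ℝ) ^ d := by rw [mul_pow, Real.rpow_natCast]
      _ ≤ l k ^ (d : ℝ) * l k ^ (-(β + ε)) := by gcongr; exact h.pow_le k
      _ = l k ^ (d - β - ε) := by rw [← Real.rpow_add hl]; congr 1; ring
      _ ≤ δ ^ (d - β - ε) := Real.rpow_le_rpow hl.le hlδ (by linarith)
  · refine ⟨k + 1, δ, by linarith, ?_⟩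
    rw [Finset.prod_range_succ, mul_assoc]
    gcongr
    calc (M k : ℝ) ^ d * δ ^ d ≤ l k ^ (-(β + ε)) * δ ^ (d : ℝ) := by
          rw [Real.rpow_natCast]; gcongr; exact h.pow_le k
      _ ≤ δ ^ (-(β + ε)) * δ ^ (d : ℝ) := by
          exact mul_le_mul_of_nonneg_right
            (Real.rpow_le_rpow_of_nonpos hδ hlδ (by linarith)) (by positivity)
      _ = δ ^ (d - β - ε) := by rw [← Real.rpow_add hδ]; congr 1; ring

theorem IsSparseScales.ofReal_le_dimH {d : ℕ} {β : ℝ} (hβ : 0 ≤ β) (hβd : β < d)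
    {l : ℕ → ℝ} {M : ℕ → ℕ} (h : IsSparseScales d β l M) (w : ℕ → Fin d → ℤ) {t : ℝ}
    (ht : 0 < t) (htd : t < d - β) : ENNReal.ofReal t ≤ dimH (latticeCantorSet l M w) := by
  have hlim : Tendsto (fun k : ℕ => (d - β) / ((k : ℝ) + 2) + 1 / (k : ℝ)) atTop (nhds 0) := by
    have h1 : Tendsto (fun k : ℕ => (d - β) / ((k : ℝ) + 2)) atTop (nhds 0) :=
      tendsto_const_nhds.div_atTop (tendsto_natCast_atTop_atTop.atTop_add tendsto_const_nhds)
    simpa using h1.add (tendsto_one_div_atTop_nhds_zero_nat (𝕜 := ℝ))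
  obtain ⟨K, hK⟩ := eventually_atTop.1
    (hlim.eventually_lt_const (show 0 < d - β - t by linarith))
  have hr : ∀ k, 0 < l k * M k := fun k =>
    mul_pos (h.pos k) (by exact_mod_cast h.one_le k)
  refine ofReal_le_dimH_of_volume_add_ne_zero (Z := digitSet d l M) (C := ENNReal.ofReal (6 ^ d))
    ht (hr (K + 1)) ENNReal.ofReal_ne_top (fun δ hδ hδK => ?_) (by
      rw [latticeCantorSet_add_digitSet h w]
      exact (isOpen_univ.measure_pos volume univ_nonempty).ne')
  obtain ⟨k, hKk, hk1, hk2⟩ : ∃ k, K + 1 ≤ k ∧ δ ≤ l k * M k ∧ l (k + 1) * M (k + 1) ≤ δ := by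
    by_contra! hcon
    have hall : ∀ k, K + 1 ≤ k → δ ≤ l k * M k := by
      intro k hk
      induction k, hk using Nat.le_induction with
      | base => exact hδK.le
      | succ k hk ih => exact (hcon k hk ih).le
    exact hδ.not_ge (ge_of_tendsto h.tendsto_mesh (eventually_atTop.2 ⟨K + 1, hall⟩))
  refine (h.volume_digitSet_le hβ hβd (by omega) hδ hk1 hk2).trans ?_
  rw [← ENNReal.ofReal_mul (by positivity)]
  have hδ1 : δ ≤ 1 := by
    have h1 := h.mesh_add_le 0 k
    rw [zero_add] at h1
    have h2 : (1 / 4 : ℝ) ^ k ≤ 1 := pow_le_one₀ (by norm_num) (by norm_num)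
    have h3 := mul_le_one₀ h.mesh_zero_le (by positivity) h2
    linarith
  refine ENNReal.ofReal_le_ofReal (mul_le_mul_of_nonneg_left ?_ (by positivity))
  exact Real.rpow_le_rpow_of_exponent_ge hδ hδ1 (by linarith [hK k (by omega)])

end

open scoped Pointwise in
/-- **Theorem 5.1.** Sum-sets avoiding a prescribed rough set. -/
theorem sumset_avoidance (d : ℕ) (hd : 1 ≤ d) (β : ℝ) (hβ0 : 0 ≤ β) (hβd : β < d)
    (Y : Set (Fin d → ℝ)) (Yi : ℕ → Set (Fin d → ℝ))
    (hYcompact : ∀ i, IsCompact (Yi i))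
    (hYdim : ∀ i, lowerMinkDim (Yi i) ≤ β)
    (hY : Y = ⋃ i, Yi i) :
    ∃ X : Set (Fin d → ℝ),
      ENNReal.ofReal ((d : ℝ) - β) ≤ dimH X ∧ Disjoint (X + X) Y := by
  obtain ⟨l, M, w, h, hav⟩ := exists_isSparseScales hd hβ0 hβd hYcompact hYdim
  refine ⟨latticeCantorSet l M w, le_of_forall_lt fun a ha => ?_, ?_⟩
  · have ha' : a ≠ ⊤ := ha.ne_top
    have hat : a.toReal < d - β := (ENNReal.lt_ofReal_iff_toReal_lt ha').1 ha
    obtain ⟨t, hat, htd⟩ := exists_between hat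
    have ht : 0 < t := ENNReal.toReal_nonneg.trans_lt hat
    exact ((ENNReal.lt_ofReal_iff_toReal_lt ha').2 hat).trans_le
      (h.ofReal_le_dimH hβ0 hβd w ht htd)
  · rw [hY, disjoint_iUnion_right]
    exact fun k => disjoint_latticeCantorSet_add (hav k)

end
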